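/- Kirchheim–Kristensen convexity at symmetric rank-one matrices: let h : ℝ^{d×d}_sym → ℝ be continuous, positively 1-homogeneous (h(tA) = t·h(A) for all t ≥ 0 and all A) and symmetric-quasiconvex. Then h is convex at every matrix of the form a⊙b: for all a, b ∈ ℝ^d there exists an affine function g : ℝ^{d×d}_sym → ℝ (i.e. g(M) = L(M) + c with L linear and c ∈ ℝ) such that g(a⊙b) = h(a⊙b) and h(M) ≥ g(M) for all M ∈ ℝ^{d×d}_sym. -/

import Mathlib

open MeasureTheory

/-- The symmetrized gradient `𝓔ψ(x) = (Dψ(x) + Dψ(x)ᵀ)/2` (via `fderiv`; a.e. defined for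
Lipschitz maps by Rademacher's theorem). -/
noncomputable def symGradE {d : ℕ} (u : EuclideanSpace ℝ (Fin d) → EuclideanSpace ℝ (Fin d))
    (x : EuclideanSpace ℝ (Fin d)) : Matrix (Fin d) (Fin d) ℝ :=
  fun i j =>
    (fderiv ℝ u x (EuclideanSpace.single j 1) i + fderiv ℝ u x (EuclideanSpace.single i 1) j) / 2

/-- The symmetric tensor product `a ⊙ b := (a ⊗ b + b ⊗ a)/2`. -/
noncomputable def symTensor {d : ℕ} (a b : Fin d → ℝ) : Matrix (Fin d) (Fin d) ℝ :=
  fun i j => (a i * b j + b i * a j) / 2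

open Filter Topology

/-- Positively 1-homogeneous functions that are midpoint convex along the directions in `D`,
with increments controlled by `p`. -/
structure IsDirSublinear {V : Type*} [AddCommGroup V] [Module ℝ V] (D : Set V) (p : V → ℝ)
    (f : V → ℝ) : Prop where
  hom : ∀ t : ℝ, 0 ≤ t → ∀ x, f (t • x) = t * f x
  mid : ∀ x, ∀ y ∈ D, 2 * f x ≤ f (x + y) + f (x - y)
  bdd : ∀ x z, f (x + z) ≤ f x + p z

section Directional

variable {V : Type*} [AddCommGroup V] [Module ℝ V] {D : Set V} {p f : V → ℝ}

/-- Increments of a midpoint convex function along a line are nondecreasing. -/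
theorem nat_mul_increment_le {f : V → ℝ} {y : V} (hmid : ∀ x, 2 * f x ≤ f (x + y) + f (x - y))
    (x : V) (n : ℕ) : n * (f (x + y) - f x) ≤ f (x + (n : ℝ) • y) - f x := by
  have step : ∀ n : ℕ, f (x + y) - f x ≤ f (x + ((n : ℝ) + 1) • y) - f (x + (n : ℝ) • y) := by
    intro n
    induction n with
    | zero => simp
    | succ n ih =>
      have h := hmid (x + ((n : ℝ) + 1) • y)
      have e1 : x + ((n : ℝ) + 1) • y + y = x + ((n : ℝ) + 1 + 1) • y := by module
      have e2 : x + ((n : ℝ) + 1) • y - y = x + (n : ℝ) • y := by module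
      rw [e1, e2] at h
      push_cast
      linarith
  induction n with
  | zero => simp
  | succ n ih =>
    have h := step n
    push_cast
    linarith

theorem IsDirSublinear.add_le (hf : IsDirSublinear D p f) (x : V) {y : V} (hy : y ∈ D) :
    f (x + y) ≤ f x + f y := by
  by_contra! hlt
  obtain ⟨n, hn⟩ := exists_nat_gt ((p x - f x) / (f (x + y) - f x - f y))
  rw [div_lt_iff₀ (by linarith)] at hn
  have h1 := nat_mul_increment_le (fun x => hf.mid x y hy) x n
  have h2 := hf.bdd ((n : ℝ) • y) x
  rw [hf.hom n n.cast_nonneg, add_comm] at h2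
  linarith

theorem IsDirSublinear.zero (hf : IsDirSublinear D p f) : f 0 = 0 := by
  simpa using hf.hom 0 le_rfl 0

/-- Passing to the recession function along `y ∈ D` makes `f` affine in direction `y`. -/
theorem IsDirSublinear.exists_affine_along (hD : ∀ (t : ℝ), ∀ y ∈ D, t • y ∈ D)
    (hf : IsDirSublinear D p f) {y : V} (hy : y ∈ D) :
    ∃ F : V → ℝ, IsDirSublinear D p F ∧ (∀ x, F x ≤ f x) ∧
      (∀ x (r : ℝ), F (x + r • y) = F x + r * f y) ∧
      ∀ z, (∀ x (r : ℝ), f (x + r • z) = f x + r * f z) →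
        ∀ x (r : ℝ), F (x + r • z) = F x + r * f z := by
  set φ : V → ℝ → ℝ := fun x t => f (x + t • y) - t * f y with hφ
  have anti : ∀ x, Antitone (φ x) := by
    intro x s t hst
    have h := hf.add_le (x + s • y) (hD (t - s) y hy)
    rw [hf.hom _ (sub_nonneg.2 hst)] at h
    have e : x + s • y + (t - s) • y = x + t • y := by module
    rw [e] at h
    simp only [hφ]
    linarith
  have lower : ∀ x, BddBelow (Set.range (φ x)) := by
    intro x
    refine ⟨-p (-x), ?_⟩
    rintro _ ⟨t, rfl⟩
    refine le_trans ?_ (anti x (le_max_left t 0))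
    have h := hf.bdd (x + max t 0 • y) (-x)
    have e : x + max t 0 • y + -x = max t 0 • y := by module
    rw [e, hf.hom _ (le_max_right t 0)] at h
    simp only [hφ]
    linarith
  have lim : ∀ x, Tendsto (φ x) atTop (𝓝 (⨅ t, φ x t)) := fun x =>
    tendsto_atTop_ciInf (anti x) (lower x)
  refine ⟨fun x => ⨅ t, φ x t, ⟨?_, ?_, ?_⟩, ?_, ?_, ?_⟩
  · intro t ht x
    rcases ht.eq_or_lt with rfl | ht
    · refine tendsto_nhds_unique (lim _) ?_
      refine tendsto_const_nhds.congr' ?_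
      filter_upwards [eventually_ge_atTop 0] with s hs
      simp [hφ, hf.hom s hs]
    · refine tendsto_nhds_unique ((lim (t • x)).comp (tendsto_id.const_mul_atTop ht))
        (((lim x).const_mul t).congr fun s => ?_)
      have e : t • x + (t * s) • y = t • (x + s • y) := by module
      simp only [hφ, Function.comp, id, e, hf.hom t ht.le]
      ring
  · intro x w hw
    refine le_of_tendsto_of_tendsto' ((lim x).const_mul 2) ((lim (x + w)).add (lim (x - w)))
      fun t => ?_
    have h := hf.mid (x + t • y) w hw
    have e1 : x + t • y + w = x + w + t • y := by module
    have e2 : x + t • y - w = x - w + t • y := by module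
    rw [e1, e2] at h
    simp only [hφ]
    linarith
  · intro x z
    refine le_of_tendsto_of_tendsto' (lim (x + z)) ((lim x).add_const (p z)) fun t => ?_
    have h := hf.bdd (x + t • y) z
    have e1 : x + t • y + z = x + z + t • y := by module
    rw [e1] at h
    simp only [hφ]
    linarith
  · intro x
    simpa [hφ] using ciInf_le (lower x) 0
  · intro x r
    refine tendsto_nhds_unique (lim _)
      ((((lim x).comp (tendsto_atTop_add_const_right _ r tendsto_id)).add_const (r * f y)).congr
        fun t => ?_)
    have e : x + r • y + t • y = x + (t + r) • y := by module
    simp only [hφ, Function.comp, id, e]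
    ring
  · intro z hz x r
    refine tendsto_nhds_unique (lim _) (((lim x).add_const (r * f z)).congr fun t => ?_)
    have e : x + r • z + t • y = x + t • y + r • z := by module
    simp only [hφ, e, hz]
    ring

theorem IsDirSublinear.exists_affine_along_finset (hD : ∀ (t : ℝ), ∀ y ∈ D, t • y ∈ D)
    (hf : IsDirSublinear D p f) {y : V} (hy : y ∈ D) (S : Finset V) (hS : ∀ z ∈ S, z ∈ D) :
    ∃ F : V → ℝ, IsDirSublinear D p F ∧ (∀ x, F x ≤ f x) ∧ F y = f y ∧
      ∀ z, z ∈ S → ∀ x (r : ℝ), F (x + r • z) = F x + r * F z := by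
  classical
  suffices ∃ F : V → ℝ, IsDirSublinear D p F ∧ (∀ x, F x ≤ f x) ∧ F y = f y ∧
      ∀ z, (z = y ∨ z ∈ S) → ∀ x (r : ℝ), F (x + r • z) = F x + r * F z by
    obtain ⟨F, h1, h2, h3, h4⟩ := this
    exact ⟨F, h1, h2, h3, fun z hz => h4 z (Or.inr hz)⟩
  induction S using Finset.induction_on with
  | empty =>
    obtain ⟨F, h1, h2, h3, -⟩ := hf.exists_affine_along hD hy
    have e : F y = f y := by simpa [h1.zero] using h3 0 1
    refine ⟨F, h1, h2, e, ?_⟩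
    rintro z (rfl | hz)
    · simpa [e] using h3
    · simp at hz
  | insert w S _ ih =>
    obtain ⟨F, h1, h2, h3, h4⟩ := ih fun z hz => hS z (Finset.mem_insert_of_mem hz)
    obtain ⟨G, g1, g2, g3, g4⟩ :=
      h1.exists_affine_along hD (hS w (Finset.mem_insert_self w S))
    have key : ∀ z, (∀ x (r : ℝ), G (x + r • z) = G x + r * F z) → G z = F z := by
      intro z hz
      simpa [g1.zero] using hz 0 1
    refine ⟨G, g1, fun x => (g2 x).trans (h2 x), ?_, ?_⟩
    · rw [key y (g4 y (h4 y (Or.inl rfl))), h3]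
    · intro z hz
      have hz' : ∀ x (r : ℝ), G (x + r • z) = G x + r * F z := by
        rcases eq_or_ne z w with rfl | hne
        · exact g3
        · exact g4 z (h4 z (hz.imp id fun h => Finset.mem_of_mem_insert_of_ne h hne))
      rw [key z hz']
      exact hz'

/-- A directionally sublinear function has a linear minorant touching it at any given point of the
cone of directions. -/
theorem IsDirSublinear.exists_linear_le (hD : ∀ (t : ℝ), ∀ y ∈ D, t • y ∈ D)
    (hf : IsDirSublinear D p f) {y : V} (hy : y ∈ D) (S : Finset V) (hS : ∀ z ∈ S, z ∈ D)
    (hspan : Submodule.span ℝ (S : Set V) = ⊤) :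
    ∃ L : V →ₗ[ℝ] ℝ, (∀ x, L x ≤ f x) ∧ L y = f y := by
  obtain ⟨F, h1, h2, h3, h4⟩ := hf.exists_affine_along_finset hD hy S hS
  have h5 : ∀ z x (r : ℝ), F (x + r • z) = F x + r * F z := by
    intro z
    have hz : z ∈ Submodule.span ℝ (S : Set V) := hspan ▸ Submodule.mem_top
    induction hz using Submodule.span_induction with
    | mem z hz => exact h4 z hz
    | zero => simp [h1.zero]
    | add z w _ _ hz hw =>
      intro x r
      have e : F (z + w) = F z + F w := by simpa using hw z 1
      rw [smul_add, ← add_assoc, hw, hz, e]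
      ring
    | smul c z _ hz =>
      intro x r
      have e : F (c • z) = c * F z := by simpa [h1.zero] using hz 0 c
      rw [smul_smul, hz, e]
      ring
  refine ⟨{ toFun := F, map_add' := fun x z => ?_, map_smul' := fun r z => ?_ }, h2, h3⟩
  · simpa using h5 z x 1
  · simpa [h1.zero] using h5 z 0 r

/-- A continuous, positively 1-homogeneous function that is midpoint convex in direction `y` is
subadditive in that direction. -/
theorem add_le_of_continuous_of_mid [TopologicalSpace V] [ContinuousAdd V] [ContinuousSMul ℝ V]
    (hf : Continuous f) (hom : ∀ t : ℝ, 0 ≤ t → ∀ x, f (t • x) = t * f x) {y : V}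
    (hmid : ∀ x, 2 * f x ≤ f (x + y) + f (x - y)) (x : V) : f (x + y) ≤ f x + f y := by
  have hinv : Tendsto (fun n : ℕ => (n : ℝ)⁻¹) atTop (𝓝 0) := tendsto_inv_atTop_nhds_zero_nat
  have hlim : Tendsto (fun n : ℕ => f ((n : ℝ)⁻¹ • x + y) - (n : ℝ)⁻¹ * f x) atTop (𝓝 (f y)) := by
    have h1 := (hf.tendsto _).comp ((hinv.smul_const x).add_const y)
    simpa using h1.sub (hinv.mul_const (f x))
  have hle : f (x + y) - f x ≤ f y := by
    refine ge_of_tendsto hlim ?_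
    filter_upwards [eventually_gt_atTop 0] with n hn
    have hn' : (0 : ℝ) < n := Nat.cast_pos.2 hn
    have h1 := nat_mul_increment_le hmid x n
    have e : (n : ℝ)⁻¹ • x + y = (n : ℝ)⁻¹ • (x + (n : ℝ) • y) := by
      rw [smul_add, inv_smul_smul₀ hn'.ne']
    rw [e, hom _ (inv_nonneg.2 hn'.le), ← mul_sub, ← div_eq_inv_mul, le_div_iff₀ hn']
    linarith
  linarith

end Directional

/-- The triangle wave `t ↦ ‖t mod 1‖` has slope `±1` away from the half-integers. -/
theorem hasDerivAt_norm_unitAddCircle {t : ℝ} (ht : ∀ k : ℤ, t ≠ k / 2) :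
    ∃ s : ℝ, (s = 1 ∨ s = -1) ∧ HasDerivAt (fun r : ℝ => ‖(r : UnitAddCircle)‖) s t := by
  have h1 : |t - round t| < 1 / 2 := by
    refine lt_of_le_of_ne (abs_sub_round t) fun h => ?_
    rcases abs_choice (t - round t) with h' | h' <;> rw [h'] at h
    · exact ht (2 * round t + 1) (by push_cast; linarith)
    · exact ht (2 * round t - 1) (by push_cast; linarith)
  have h2 : t - round t ≠ 0 := fun h => ht (2 * round t) (by push_cast; linarith)
  have heq : (fun r : ℝ => ‖(r : UnitAddCircle)‖) =ᶠ[𝓝 t] fun r => |r - round t| := by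
    have : ∀ᶠ r : ℝ in 𝓝 t, |r - round t| < 1 / 2 :=
      (by fun_prop : Continuous fun r : ℝ => |r - round t|).continuousAt.eventually_lt_const h1
    filter_upwards [this] with r hr
    have e : (r : UnitAddCircle) = ((r - round t : ℝ) : UnitAddCircle) := by
      rw [AddCircle.coe_sub]
      have : ((round t : ℝ) : UnitAddCircle) = 0 := by
        rw [AddCircle.coe_eq_zero_iff]
        exact ⟨round t, by simp⟩
      simp [this]
    rw [e, AddCircle.norm_coe_eq_abs_iff _ one_ne_zero]
    simpa using hr.le
  rcases lt_or_gt_of_ne h2 with h | h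
  · refine ⟨-1, Or.inr rfl, HasDerivAt.congr_of_eventuallyEq ?_ heq⟩
    exact (hasDerivAt_abs_neg h).comp_sub_const t (round t : ℝ)
  · refine ⟨1, Or.inl rfl, HasDerivAt.congr_of_eventuallyEq ?_ heq⟩
    exact (hasDerivAt_abs_pos h).comp_sub_const t (round t : ℝ)

/-- The truncated triangle wave oscillating in direction `b` with frequency `c`. -/
noncomputable def laminateProfile {E : Type*} [NormedAddCommGroup E] [InnerProductSpace ℝ E]
    (b : E) (c : ℝ) (x : E) : ℝ :=
  min (‖((c * inner ℝ b x : ℝ) : UnitAddCircle)‖ / c) (max 0 (1 - ‖x‖))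

section Profile

variable {E : Type*} [NormedAddCommGroup E] [InnerProductSpace ℝ E]

theorem laminateProfile_neg (b : E) (c : ℝ) (x : E) :
    laminateProfile b c (-x) = laminateProfile b c x := by
  simp [laminateProfile]

theorem laminateProfile_eq_zero (b : E) {c : ℝ} (hc : 0 < c) {x : E} (hx : 1 ≤ ‖x‖) :
    laminateProfile b c x = 0 := by
  rw [laminateProfile, max_eq_left (by linarith), min_eq_right (by positivity)]

theorem lipschitzWith_laminateProfile (b : E) {c : ℝ} (hc : 0 < c) :
    LipschitzWith (max ‖b‖₊ 1) (laminateProfile b c) := by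
  have h1 : LipschitzWith ‖b‖₊ fun x : E => ‖((c * inner ℝ b x : ℝ) : UnitAddCircle)‖ / c := by
    refine LipschitzWith.of_dist_le_mul fun x y => ?_
    rw [Real.dist_eq, ← sub_div, abs_div, abs_of_pos hc, div_le_iff₀ hc]
    refine (abs_norm_sub_norm_le _ _).trans ?_
    rw [← AddCircle.coe_sub, ← mul_sub, ← inner_sub_right]
    refine QuotientAddGroup.norm_mk_le_norm.trans ?_
    rw [norm_mul, Real.norm_of_nonneg hc.le, dist_eq_norm, coe_nnnorm, mul_comm]
    gcongr
    exact norm_inner_le_norm _ _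
  have h2 : LipschitzWith 1 fun x : E => max 0 (1 - ‖x‖) := by
    refine LipschitzWith.const_max (LipschitzWith.of_dist_le_mul fun x y => ?_) 0
    rw [Real.dist_eq, dist_eq_norm, NNReal.coe_one, one_mul, sub_sub_sub_cancel_left, norm_sub_rev]
    exact abs_norm_sub_norm_le _ _
  exact h1.min h2

theorem hasFDerivAt_laminateProfile (b : E) {c : ℝ} (hc : 0 < c) {x : E}
    (hx : 1 / c < 1 - ‖x‖) (hb : ∀ k : ℤ, c * inner ℝ b x ≠ k / 2) :
    ∃ s : ℝ, (s = 1 ∨ s = -1) ∧ HasFDerivAt (laminateProfile b c) (s • innerSL ℝ b) x := by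
  obtain ⟨s, hs, hd⟩ := hasDerivAt_norm_unitAddCircle hb
  refine ⟨s, hs, HasFDerivAt.congr_of_eventuallyEq
    (f := fun x : E => c⁻¹ * ‖((c * inner ℝ b x : ℝ) : UnitAddCircle)‖) ?_ ?_⟩
  · have h1 : HasFDerivAt (fun x : E => c * inner ℝ b x) (c • innerSL ℝ b) x :=
      (innerSL ℝ b).hasFDerivAt.const_mul c
    have h2 := (hd.comp_hasFDerivAt x h1).const_mul c⁻¹
    refine h2.congr_fderiv ?_
    rw [smul_smul, smul_smul]
    congr 1
    field_simp
  · have : ∀ᶠ y : E in 𝓝 x, 1 / c < 1 - ‖y‖ :=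
      (by fun_prop : Continuous fun y : E => 1 - ‖y‖).continuousAt.eventually_const_lt hx
    filter_upwards [this] with y hy
    rw [laminateProfile, min_eq_left, div_eq_inv_mul]
    refine le_trans ?_ (hy.le.trans (le_max_right _ _))
    gcongr
    refine (AddCircle.norm_le_half_period (1 : ℝ) one_ne_zero).trans ?_
    norm_num

theorem ae_mul_inner_ne_half_int [FiniteDimensional ℝ E] [MeasurableSpace E] [BorelSpace E]
    {b : E} (hb : b ≠ 0) {c : ℝ} (hc : c ≠ 0) :
    ∀ᵐ x : E, ∀ k : ℤ, c * inner ℝ b x ≠ k / 2 := by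
  have hsurj : Function.Surjective (innerSL ℝ b).toLinearMap := by
    refine LinearMap.surjective fun h => hb ?_
    have := LinearMap.congr_fun h b
    simpa using this
  have := (Set.countable_range fun k : ℤ => (k : ℝ) / 2 / c).ae_notMem (volume : Measure ℝ)
  have := (ae_comp_linearMap_mem_iff (innerSL ℝ b).toLinearMap (volume : Measure E)
    (volume : Measure ℝ) hsurj
    (Set.countable_range fun k : ℤ => (k : ℝ) / 2 / c).measurableSet.compl).2 this
  filter_upwards [this] with x hx k hk
  refine hx ⟨k, ?_⟩
  simp only [← hk]
  simp [mul_div_cancel_left₀ _ hc]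

end Profile

section Laminate

variable {d : ℕ}

/-- The symmetrized gradient of `u • a` is a multiple of `a ⊙ b` wherever `∇u` is parallel to `b`. -/
theorem symGradE_eq_of_hasFDerivAt {u : EuclideanSpace ℝ (Fin d) → ℝ} {a b : Fin d → ℝ} {s : ℝ}
    {x : EuclideanSpace ℝ (Fin d)}
    (hu : HasFDerivAt u (s • innerSL ℝ (WithLp.toLp 2 b)) x) :
    symGradE (fun y => u y • WithLp.toLp 2 a) x = s • symTensor a b := by
  have h := (hu.smul_const (WithLp.toLp 2 a)).fderiv
  ext i j
  simp only [symGradE, h, symTensor, Matrix.smul_apply]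
  simp [EuclideanSpace.inner_single_right]
  ring

theorem symGradE_neg_of_even {u : EuclideanSpace ℝ (Fin d) → EuclideanSpace ℝ (Fin d)}
    (hu : ∀ x, u (-x) = u x) (x : EuclideanSpace ℝ (Fin d)) :
    symGradE u (-x) = -symGradE u x := by
  have h : fderiv ℝ u (-x) = -fderiv ℝ u x := by
    have := (ContinuousLinearEquiv.neg ℝ).comp_right_fderiv (f := u) (x := x)
    simp only [Function.comp_def, ContinuousLinearEquiv.neg_apply, hu] at this
    ext v : 1
    simp [this]
  ext i j
  simp only [symGradE, h, Matrix.neg_apply, neg_apply, PiLp.neg_apply]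
  ring

theorem isSymm_symGradE (u : EuclideanSpace ℝ (Fin d) → EuclideanSpace ℝ (Fin d))
    (x : EuclideanSpace ℝ (Fin d)) : (symGradE u x).IsSymm := by
  ext i j
  simp only [symGradE, Matrix.transpose_apply]
  ring

theorem isSymm_symTensor (a b : Fin d → ℝ) : (symTensor a b).IsSymm := by
  ext i j
  simp only [symTensor, Matrix.transpose_apply]
  ring

/-- Along uniformly Lipschitz maps, a continuous function of the symmetrized gradient is measurable
and uniformly bounded. -/
theorem exists_bound_comp_symGradE {h : Matrix (Fin d) (Fin d) ℝ → ℝ}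
    (hc : ContinuousOn h {M | M.IsSymm}) {A : Matrix (Fin d) (Fin d) ℝ} (hA : A.IsSymm)
    (K : NNReal) :
    ∃ C : ℝ, ∀ u : EuclideanSpace ℝ (Fin d) → EuclideanSpace ℝ (Fin d), LipschitzWith K u →
      Measurable (fun x => h (A + symGradE u x)) ∧ ∀ x, |h (A + symGradE u x)| ≤ C := by
  let T : (EuclideanSpace ℝ (Fin d) →L[ℝ] EuclideanSpace ℝ (Fin d)) → Matrix (Fin d) (Fin d) ℝ :=
    fun F i j => (F (EuclideanSpace.single j 1) i + F (EuclideanSpace.single i 1) j) / 2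
  have hT : Continuous T := by
    refine continuous_pi fun i => continuous_pi fun j => ?_
    fun_prop
  have hq : Continuous fun F => h (A + T F) := by
    refine hc.comp_continuous (by fun_prop) fun F => hA.add ?_
    ext i j
    change T F j i = T F i j
    simp only [T, add_comm]
  obtain ⟨C, hC⟩ := (isCompact_closedBall
    (0 : EuclideanSpace ℝ (Fin d) →L[ℝ] EuclideanSpace ℝ (Fin d)) K).exists_bound_of_continuousOn
      hq.continuousOn
  refine ⟨C, fun u hu => ⟨hq.measurable.comp (measurable_fderiv ℝ u), fun x => hC _ ?_⟩⟩
  rw [mem_closedBall_zero_iff]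
  exact norm_fderiv_le_of_lipschitz ℝ hu

/-- Symmetric-quasiconvexity implies midpoint convexity along symmetrized rank-one directions. -/
theorem midpoint_convex_symTensor {h : Matrix (Fin d) (Fin d) ℝ → ℝ}
    (hc : ContinuousOn h {M | M.IsSymm})
    (hqc : ∀ A : Matrix (Fin d) (Fin d) ℝ, A.IsSymm →
      ∀ ψ : EuclideanSpace ℝ (Fin d) → EuclideanSpace ℝ (Fin d),
        (∃ K, LipschitzWith K ψ) → (∀ x, 1 ≤ ‖x‖ → ψ x = 0) →
        h A ≤ ⨍ y in Metric.ball (0 : EuclideanSpace ℝ (Fin d)) 1, h (A + symGradE ψ y))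
    {A : Matrix (Fin d) (Fin d) ℝ} (hA : A.IsSymm) (a b : Fin d → ℝ) :
    2 * h A ≤ h (A + symTensor a b) + h (A - symTensor a b) := by
  rcases eq_or_ne b 0 with rfl | hb
  · have : symTensor a 0 = 0 := by
      ext i j
      simp [symTensor]
    rw [this, add_zero, sub_zero, two_mul]
  have hb' : WithLp.toLp 2 b ≠ 0 := by simpa using hb
  let ψ : ℕ → EuclideanSpace ℝ (Fin d) → EuclideanSpace ℝ (Fin d) := fun n x =>
    laminateProfile (WithLp.toLp 2 b) ((n : ℝ) + 1) x • WithLp.toLp 2 a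
  have hpos : ∀ n : ℕ, (0 : ℝ) < n + 1 := fun n => by positivity
  have hlip : ∀ n, LipschitzWith (‖WithLp.toLp 2 a‖₊ * max ‖WithLp.toLp 2 b‖₊ 1) (ψ n) := by
    intro n
    refine LipschitzWith.of_dist_le_mul fun x y => ?_
    have h1 := (lipschitzWith_laminateProfile (WithLp.toLp 2 b) (hpos n)).dist_le_mul x y
    rw [dist_eq_norm, ← sub_smul, norm_smul, ← dist_eq_norm, NNReal.coe_mul, coe_nnnorm,
      mul_comm, mul_assoc]
    gcongr
  have heven : ∀ n x, ψ n (-x) = ψ n x := fun n x => by simp only [ψ, laminateProfile_neg]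
  obtain ⟨C, hC⟩ := exists_bound_comp_symGradE hc hA (‖WithLp.toLp 2 a‖₊ * max ‖WithLp.toLp 2 b‖₊ 1)
  set s : Set (EuclideanSpace ℝ (Fin d)) := Metric.ball 0 1 with hs
  have hint : ∀ n, IntegrableOn (fun y => h (A + symGradE (ψ n) y)) s := fun n =>
    Measure.integrableOn_of_bounded measure_ball_lt_top.ne
      (hC _ (hlip n)).1.aestronglyMeasurable (ae_of_all _ (hC _ (hlip n)).2)
  have hmeas : ∀ n, Measurable fun y => h (A - symGradE (ψ n) y) := by
    intro n
    have := (hC _ (hlip n)).1.comp measurable_neg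
    simpa [Function.comp_def, symGradE_neg_of_even (heven n), sub_eq_add_neg] using this
  have hbd : ∀ n y, |h (A - symGradE (ψ n) y)| ≤ C := by
    intro n y
    have := (hC _ (hlip n)).2 (-y)
    rwa [symGradE_neg_of_even (heven n), ← sub_eq_add_neg] at this
  have hint' : ∀ n, IntegrableOn (fun y => h (A - symGradE (ψ n) y)) s := fun n =>
    Measure.integrableOn_of_bounded measure_ball_lt_top.ne
      (hmeas n).aestronglyMeasurable (ae_of_all _ (hbd n))
  have hrefl : ∀ n, ∫ y in s, h (A - symGradE (ψ n) y) = ∫ y in s, h (A + symGradE (ψ n) y) := by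
    intro n
    have h1 := (Measure.measurePreserving_neg
      (volume : Measure (EuclideanSpace ℝ (Fin d)))).setIntegral_preimage_emb
      (MeasurableEquiv.neg _).measurableEmbedding (fun y => h (A + symGradE (ψ n) y)) s
    rw [← h1]
    have e : (fun x => -x) ⁻¹' s = s := by
      ext x
      simp [hs]
    simp [e, symGradE_neg_of_even (heven n), sub_eq_add_neg]
  have hlim : Tendsto (fun n => ∫ y in s, (h (A + symGradE (ψ n) y) + h (A - symGradE (ψ n) y)))
      atTop (𝓝 (∫ _ in s, (h (A + symTensor a b) + h (A - symTensor a b)))) := by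
    refine tendsto_integral_of_dominated_convergence (fun _ => C + C)
      (fun n => ((hC _ (hlip n)).1.add (hmeas n)).aestronglyMeasurable)
      (integrableOn_const measure_ball_lt_top.ne)
      (fun n => ae_of_all _ fun y => (norm_add_le _ _).trans
        (add_le_add ((hC _ (hlip n)).2 y) (hbd n y))) ?_
    have hae : ∀ᵐ y : EuclideanSpace ℝ (Fin d), ∀ n : ℕ, ∀ k : ℤ,
        ((n : ℝ) + 1) * inner ℝ (WithLp.toLp 2 b) y ≠ k / 2 :=
      ae_all_iff.2 fun n => ae_mul_inner_ne_half_int hb' (hpos n).ne'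
    filter_upwards [ae_restrict_of_ae hae, ae_restrict_mem measurableSet_ball] with y hy hys
    refine tendsto_const_nhds.congr' ?_
    have hn : ∀ᶠ n : ℕ in atTop, 1 / ((n : ℝ) + 1) < 1 - ‖y‖ :=
      tendsto_one_div_add_atTop_nhds_zero_nat.eventually_lt_const
        (sub_pos.2 (mem_ball_zero_iff.1 hys))
    filter_upwards [hn] with n hn
    obtain ⟨σ, hσ, hd⟩ := hasFDerivAt_laminateProfile (WithLp.toLp 2 b) (hpos n) hn (hy n)
    have e : symGradE (ψ n) y = σ • symTensor a b := symGradE_eq_of_hasFDerivAt hd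
    rw [e]
    rcases hσ with rfl | rfl
    · simp
    · simp [sub_eq_add_neg, add_comm]
  have hv : 0 < (volume : Measure (EuclideanSpace ℝ (Fin d))).real s :=
    ENNReal.toReal_pos (Metric.measure_ball_pos _ _ one_pos).ne' measure_ball_lt_top.ne
  rw [setIntegral_const, smul_eq_mul] at hlim
  have hle : ∀ n, volume.real s * (2 * h A) ≤
      ∫ y in s, (h (A + symGradE (ψ n) y) + h (A - symGradE (ψ n) y)) := by
    intro n
    rw [integral_add (hint n) (hint' n), hrefl]
    have h1 := hqc A hA (ψ n) ⟨_, hlip n⟩ fun x hx => by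
      simp only [ψ, laminateProfile_eq_zero _ (hpos n) hx, zero_smul]
    rw [setAverage_eq, smul_eq_mul, ← div_eq_inv_mul, le_div_iff₀ hv] at h1
    linarith
  exact le_of_mul_le_mul_left (ge_of_tendsto' hlim hle) hv

end Laminate

/-- Kirchheim–Kristensen: a continuous, positively 1-homogeneous, symmetric-quasiconvex
function `h` on the symmetric matrices is convex at every matrix `a ⊙ b`: there is an
affine function `g = L + c` with `g(a ⊙ b) = h(a ⊙ b)` and `h ≥ g` on the symmetric
matrices. Symmetric-quasiconvexity is the requirement `h(A) ≤ ⨍_{B₁} h(A + 𝓔ψ)` for all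
Lipschitz `ψ` vanishing outside `B₁`. -/
theorem kirchheim_kristensen {d : ℕ} (h : Matrix (Fin d) (Fin d) ℝ → ℝ)
    (hc : ContinuousOn h {M | M.IsSymm})
    (hhom : ∀ t : ℝ, 0 ≤ t → ∀ A : Matrix (Fin d) (Fin d) ℝ, A.IsSymm → h (t • A) = t * h A)
    (hqc : ∀ A : Matrix (Fin d) (Fin d) ℝ, A.IsSymm →
      ∀ ψ : EuclideanSpace ℝ (Fin d) → EuclideanSpace ℝ (Fin d),
        (∃ K, LipschitzWith K ψ) → (∀ x, 1 ≤ ‖x‖ → ψ x = 0) →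
        h A ≤ ⨍ y in Metric.ball (0 : EuclideanSpace ℝ (Fin d)) 1, h (A + symGradE ψ y))
    (a b : Fin d → ℝ) :
    ∃ (L : Matrix (Fin d) (Fin d) ℝ →ₗ[ℝ] ℝ) (c : ℝ),
      L (symTensor a b) + c = h (symTensor a b) ∧
      ∀ M : Matrix (Fin d) (Fin d) ℝ, M.IsSymm → L M + c ≤ h M := by
  set S : Matrix (Fin d) (Fin d) ℝ → Matrix (Fin d) (Fin d) ℝ :=
    fun M => (1 / 2 : ℝ) • (M + M.transpose) with hS
  have hSsymm : ∀ M, (S M).IsSymm := fun M => by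
    ext i j
    simp [hS, add_comm]
  have hSid : ∀ M : Matrix (Fin d) (Fin d) ℝ, M.IsSymm → S M = M := fun M hM => by
    simp only [hS, hM.eq]
    module
  have hSadd : ∀ M N, S (M + N) = S M + S N := fun M N => by
    simp only [hS, Matrix.transpose_add]
    module
  have hSsub : ∀ M N, S (M - N) = S M - S N := fun M N => by
    simp only [hS, Matrix.transpose_sub]
    module
  have hSsmul : ∀ (t : ℝ) M, S (t • M) = t • S M := fun t M => by
    simp only [hS, Matrix.transpose_smul]
    module
  have hSvec : ∀ u v, S (Matrix.vecMulVec u v) = symTensor u v := fun u v => by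
    ext i j
    simp [hS, symTensor, Matrix.vecMulVec_apply]
    ring
  set D : Set (Matrix (Fin d) (Fin d) ℝ) := {M | ∃ u v, M = Matrix.vecMulVec u v}
  have hDsmul : ∀ (t : ℝ), ∀ y ∈ D, t • y ∈ D := by
    rintro t _ ⟨u, v, rfl⟩
    exact ⟨t • u, v, (Matrix.smul_vecMulVec _ _ _).symm⟩
  have hsingle : ∀ i j, Matrix.single i j (1 : ℝ) ∈ D := fun i j =>
    ⟨_, _, Matrix.single_eq_single_vecMulVec_single i j⟩
  have hfc : Continuous fun M => h (S M) := hc.comp_continuous (by fun_prop) hSsymm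
  have hom : ∀ t : ℝ, 0 ≤ t → ∀ M, h (S (t • M)) = t * h (S M) := fun t ht M => by
    rw [hSsmul, hhom t ht _ (hSsymm M)]
  have hmid : ∀ M, ∀ N ∈ D, 2 * h (S M) ≤ h (S (M + N)) + h (S (M - N)) := by
    rintro M _ ⟨u, v, rfl⟩
    rw [hSadd, hSsub, hSvec]
    exact midpoint_convex_symTensor hc hqc (hSsymm M) u v
  have hbdd : ∀ N, ∃ c, ∀ M, h (S (M + N)) ≤ h (S M) + c := by
    intro N
    induction N using Matrix.induction_on' with
    | h_zero => exact ⟨0, by simp⟩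
    | h_add P Q hP hQ =>
      obtain ⟨c₁, h₁⟩ := hP
      obtain ⟨c₂, h₂⟩ := hQ
      refine ⟨c₁ + c₂, fun M => ?_⟩
      rw [← add_assoc]
      linarith [h₁ M, h₂ (M + P)]
    | h_std_basis i j r =>
      refine ⟨h (S (Matrix.single i j r)), fun M => ?_⟩
      refine add_le_of_continuous_of_mid hfc hom (fun M => hmid M _ ?_) M
      simpa using hDsmul r _ (hsingle i j)
  choose p hp using hbdd
  have hf : IsDirSublinear D p fun M => h (S M) := ⟨hom, hmid, fun M N => hp N M⟩
  obtain ⟨L, hL, hLab⟩ := hf.exists_linear_le hDsmul ⟨a, b, rfl⟩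
    (Finset.univ.image fun ij : Fin d × Fin d => Matrix.single ij.1 ij.2 (1 : ℝ))
    (by
      simp only [Finset.mem_image, Finset.mem_univ, true_and]
      rintro _ ⟨ij, rfl⟩
      exact hsingle _ _)
    (by
      rw [← (Matrix.stdBasis ℝ (Fin d) (Fin d)).span_eq]
      congr 1
      ext M
      simp [Matrix.stdBasis_eq_single])
  have hskew : ∀ M, S M = 0 → L M = 0 := by
    intro M hM
    have h0 : h 0 = 0 := by simpa using hhom 0 le_rfl 0 Matrix.isSymm_zero
    have h1 := hL M
    have h2 := hL ((-1 : ℝ) • M)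
    rw [map_smul, hSsmul, hM, smul_zero, h0, smul_eq_mul] at h2
    rw [hM, h0] at h1
    linarith
  refine ⟨L, 0, ?_, fun M hM => ?_⟩
  · have h1 := hskew (symTensor a b - Matrix.vecMulVec a b) (by
      rw [hSsub, hSvec, hSid _ (isSymm_symTensor a b), sub_self])
    rw [map_sub, sub_eq_zero] at h1
    rw [add_zero, h1, hLab, hSvec]
  · simpa [hSid M hM] using hL M
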